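/- Let s : ℕ → ℚ be strictly monotone increasing with 0 < s n and s n < 1 for all n, set L := ⨆ n, (s n : ℝ), and assume L is not a computable real. Define A := {x : ℝ | x is a computable real ∧ x ∈ Icc 0 1 ∧ x < L}. Then: (i) A is relatively open in the computable points of [0,1], i.e. for every x ∈ A there exists ε > 0 such that every computable real y ∈ Icc 0 1 with |y - x| < ε lies in A; and (ii) A is sequentially closed with respect to computable limits, i.e. for every sequence u : ℕ → ℝ with u n ∈ A for all n, if u tends to a limit x which is a computable real, then x ∈ A. -/

import Mathlib

/-- A real number is computable if some computable sequence of rationals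
approximates it with error at most `(1/2)^n`. -/
def IsComputableReal (x : ℝ) : Prop :=
  ∃ f : ℕ → ℚ, Computable f ∧ ∀ n : ℕ, |x - (f n : ℝ)| ≤ (1 / 2 : ℝ) ^ n

theorem specker_lower_set_open_and_sequentially_closed
    (s : ℕ → ℚ) (hs : StrictMono s) (hpos : ∀ n, 0 < s n) (hlt : ∀ n, s n < 1)
    (L : ℝ) (hL : L = ⨆ n, (s n : ℝ)) (hnc : ¬ IsComputableReal L)
    (A : Set ℝ) (hA : A = {x : ℝ | IsComputableReal x ∧ x ∈ Set.Icc (0 : ℝ) 1 ∧ x < L}) :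
    (∀ x ∈ A, ∃ ε > 0, ∀ y : ℝ, IsComputableReal y → y ∈ Set.Icc (0 : ℝ) 1 →
        |y - x| < ε → y ∈ A) ∧
    (∀ u : ℕ → ℝ, (∀ n, u n ∈ A) → ∀ x : ℝ, IsComputableReal x →
        Filter.Tendsto u Filter.atTop (nhds x) → x ∈ A) := by
  subst hA
  constructor
  · rintro x ⟨-, -, hxL⟩
    refine ⟨L - x, sub_pos.2 hxL, fun y hy hy01 hyx => ⟨hy, hy01, ?_⟩⟩
    linarith [(abs_lt.1 hyx).2]
  · intro u hu x hx hux
    refine ⟨hx, isClosed_Icc.mem_of_tendsto hux (.of_forall fun n => (hu n).2.1), ?_⟩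
    refine (le_of_tendsto' hux fun n => (hu n).2.2.le).lt_of_ne ?_
    rintro rfl
    exact hnc hx
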